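/- Let p be a prime with p > 3. If p ≡ 1 (mod 4), then Σ_{k=0}^{p−1} C(2k,k)·C(4k,2k) / (64^k (4k + 3)) ≡ (−1)^{(p−1)/4} · (2^{p−1} + 1) / ( 6·C((p−1)/2, (p−1)/4) ) (mod p²). If p ≡ 3 (mod 4), then Σ_{k=0}^{p−1} C(2k,k)·C(4k,2k) / (64^k (4k + 1)) ≡ (−1)^{(p+1)/4} · (2^{p−1} + 2p + 1) / ( 6·C((p−3)/2, (p−3)/4) ) (mod p²). -/

import Mathlib

/-- A rational number is a `p`-integer if its denominator (in lowest terms)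
is not divisible by `p`. -/
def isPInt (p : ℕ) (x : ℚ) : Prop := ¬ p ∣ x.den

/-- For `p`-integers `u, v`, `u ≡ v (mod p^k)` means `(u - v)/p^k` is a `p`-integer. -/
def pCong (p k : ℕ) (u v : ℚ) : Prop := isPInt p ((u - v) / (p : ℚ) ^ k)

section
open Finset

/-- The coefficient `C(a,k) C(-1-a,k)`, written as a product. -/
def legendreCoeff (a : ℚ) (k : ℕ) : ℚ :=
  ∏ i ∈ range k, ((i : ℚ) * (i + 1) - a * (a + 1)) / ((i : ℚ) + 1) ^ 2

lemma legendreCoeff_succ (a : ℚ) (k : ℕ) :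
    ((k : ℚ) + 1) ^ 2 * legendreCoeff a (k + 1) =
      ((k : ℚ) * (k + 1) - a * (a + 1)) * legendreCoeff a k := by
  have : (k : ℚ) + 1 ≠ 0 := by positivity
  rw [legendreCoeff, prod_range_succ, ← legendreCoeff]
  field_simp

lemma legendreCoeff_zero (a : ℚ) : legendreCoeff a 0 = 1 := by simp [legendreCoeff]

lemma legendreCoeff_natCast_eq_zero {n k : ℕ} (h : n < k) : legendreCoeff n k = 0 :=
  prod_eq_zero (mem_range.2 h) (by simp)

/-- The truncated Mellin transform of the Legendre function. -/
def legendreSum (M : ℕ) (a x : ℚ) : ℚ := ∑ k ∈ range M, legendreCoeff a k / (k + x)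

lemma legendreSum_add_one (M : ℕ) (a b : ℚ) (hb : ∀ k : ℕ, (k : ℚ) + b ≠ 0) :
    (b - a) * (b + a + 1) * legendreSum M a (b + 1) =
      b ^ 2 * legendreSum M a b + (M : ℚ) ^ 2 * legendreCoeff a M / (M + b) := by
  induction M with
  | zero => simp [legendreSum]
  | succ M ih =>
    have h0 := hb M
    have h1 := hb (M + 1)
    have h2 := legendreCoeff_succ a M
    simp only [legendreSum, sum_range_succ] at ih ⊢
    push_cast at h1 ⊢
    have h3 : (M : ℚ) + (b + 1) ≠ 0 := by intro h; apply h1; linarith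
    rw [mul_add, ih, h2]
    have h4 : (M : ℚ) + 1 + b = M + (b + 1) := by ring
    rw [h4]
    field_simp
    ring

lemma legendreCoeff_add_one (a : ℚ) (k : ℕ) :
    (a + 1 - k) * legendreCoeff (a + 1) k = (a + 1 + k) * legendreCoeff a k := by
  induction k with
  | zero => simp [legendreCoeff]
  | succ k ih =>
    have h : ((k : ℚ) + 1) ^ 2 ≠ 0 := by positivity
    apply mul_left_cancel₀ h
    have h1 := legendreCoeff_succ a k
    have h2 := legendreCoeff_succ (a + 1) k
    push_cast
    linear_combination (a + 1 - (k + 1)) * h2 - (a + 1 + (k + 1)) * h1 -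
      (a - k) * (a + 2 + k) * ih

lemma sum_legendreCoeff_add_one (M : ℕ) (a : ℚ) :
    (a + 1) ^ 2 * ∑ k ∈ range M, (legendreCoeff (a + 1) k + legendreCoeff a k) =
      -(M : ℚ) ^ 2 * (legendreCoeff (a + 1) M + legendreCoeff a M) := by
  induction M with
  | zero => simp
  | succ M ih =>
    rw [sum_range_succ, mul_add, ih]
    push_cast
    linear_combination legendreCoeff_succ a M + legendreCoeff_succ (a + 1) M -
      legendreCoeff_add_one a M

lemma legendreSum_natCast_succ {M n : ℕ} (h : n + 1 < M) {x : ℚ} (hx : 0 < x) :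
    ((n : ℚ) + 1 + x) * legendreSum M ((n + 1 : ℕ) : ℚ) x =
      ((n : ℚ) + 1 - x) * legendreSum M n x := by
  have h1 := sum_legendreCoeff_add_one M n
  have e1 := legendreCoeff_natCast_eq_zero h
  push_cast at e1
  rw [e1, legendreCoeff_natCast_eq_zero (by omega : n < M), add_zero, mul_zero] at h1
  have h2 := (mul_eq_zero.1 h1).resolve_left (by positivity)
  rw [← sub_eq_zero, ← h2, legendreSum, legendreSum, mul_sum, mul_sum, ← sum_sub_distrib]
  refine sum_congr rfl fun k _ => ?_
  have h3 : (k : ℚ) + x ≠ 0 := by positivity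
  have h4 := legendreCoeff_add_one n k
  push_cast
  field_simp
  linear_combination h4

lemma legendreSum_natCast {M n : ℕ} (h : n < M) {x : ℚ} (hx : 0 < x) :
    legendreSum M n x * (x * ∏ i ∈ range n, ((i : ℚ) + 1 + x)) =
      ∏ i ∈ range n, ((i : ℚ) + 1 - x) := by
  induction n with
  | zero =>
    rw [legendreSum, sum_eq_single_of_mem 0 (mem_range.2 h)]
    · simp [legendreCoeff_zero, hx.ne']
    · intro k _ hk
      rw [legendreCoeff_natCast_eq_zero (by omega), zero_div]
  | succ n ih =>
    rw [prod_range_succ, prod_range_succ, ← ih (by omega)]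
    linear_combination (x * ∏ i ∈ range n, ((i : ℚ) + 1 + x)) * legendreSum_natCast_succ h hx

lemma legendreCoeff_quarter {a : ℚ} (ha : a * (a + 1) = -3 / 16) (k : ℕ) :
    legendreCoeff a k = (2 * k).choose k * (4 * k).choose (2 * k) / 64 ^ k := by
  have key : ∀ k, legendreCoeff a k * 64 ^ k = Nat.centralBinom k * Nat.centralBinom (2 * k) := by
    intro k
    induction k with
    | zero => simp [legendreCoeff]
    | succ k ih =>
      have h1 := Nat.succ_mul_centralBinom_succ k
      have h2 := Nat.succ_mul_centralBinom_succ (2 * k)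
      have h3 := Nat.succ_mul_centralBinom_succ (2 * k + 1)
      have h4 := legendreCoeff_succ a k
      rw [ha] at h4
      qify at h1 h2 h3
      rw [show 2 * (k + 1) = 2 * k + 1 + 1 by ring]
      have h5 : ((k : ℚ) + 1) ^ 2 * (2 * k + 1) ≠ 0 := by positivity
      apply mul_left_cancel₀ h5
      set c := (Nat.centralBinom (k + 1) : ℚ)
      set d := (Nat.centralBinom (2 * k + 1 + 1) : ℚ)
      have e1 : ((k : ℚ) + 1) * c = 2 * (2 * k + 1) * Nat.centralBinom k := h1
      have e2 : (2 * (k : ℚ) + 1) * ((k + 1) * d) =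
          2 * (4 * k + 3) * (2 * (4 * k + 1) * Nat.centralBinom (2 * k)) / 2 := by
        linear_combination (2 * (k : ℚ) + 1) / 2 * h3 + (4 * k + 3) * h2
      calc _ = (((k : ℚ) + 1) ^ 2 * legendreCoeff a (k + 1)) * (2 * k + 1) * 64 ^ (k + 1) := by
            ring
        _ = ((k * (k + 1) - -3 / 16) * (2 * k + 1) * 64) * (legendreCoeff a k * 64 ^ k) := by
          rw [h4]; ring
        _ = (((k : ℚ) + 1) * c) * ((2 * (k : ℚ) + 1) * ((k + 1) * d)) := by
          rw [ih, e1, e2]; ring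
        _ = _ := by ring
  rw [eq_div_iff (by positivity), key, Nat.centralBinom, Nat.centralBinom]
  ring_nf


/-- The real part of `(1 + i) ^ N` when `N ≤ 2 * K + 1`. -/
def altEven (K N : ℕ) : ℤ := ∑ j ∈ range (K + 1), (-1) ^ j * (N.choose (2 * j) : ℤ)

/-- The imaginary part of `(1 + i) ^ N` when `N ≤ 2 * K + 2`. -/
def altOdd (K N : ℕ) : ℤ := ∑ j ∈ range (K + 1), (-1) ^ j * (N.choose (2 * j + 1) : ℤ)

lemma altOdd_succ (K N : ℕ) : altOdd K (N + 1) = altOdd K N + altEven K N := by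
  rw [altOdd, altOdd, altEven, ← sum_add_distrib]
  refine sum_congr rfl fun j _ => ?_
  rw [Nat.choose_succ_succ']; push_cast; ring

lemma altEven_succ {K N : ℕ} (h : N ≤ 2 * K) :
    altEven K (N + 1) = altEven K N - altOdd K N := by
  rw [altEven, altEven, altOdd, sum_range_succ', sum_range_succ' _ K, sum_range_succ _ K,
    Nat.choose_eq_zero_of_lt (by omega : N < 2 * K + 1), Nat.cast_zero, mul_zero ((-1 : ℤ) ^ K),
    add_zero (∑ x ∈ range K, (-1) ^ x * (N.choose (2 * x + 1) : ℤ)), add_sub_right_comm,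
    ← sum_sub_distrib]
  congr 1
  · refine sum_congr rfl fun j _ => ?_
    rw [show 2 * (j + 1) = 2 * j + 1 + 1 by ring, Nat.choose_succ_succ']; push_cast; ring
  · simp

lemma alt_four_mul {K m : ℕ} (h : 4 * m ≤ 2 * K) :
    altEven K (4 * m) = (-4) ^ m ∧ altOdd K (4 * m) = 0 := by
  induction m with
  | zero =>
    constructor
    · rw [altEven, sum_eq_single_of_mem 0 (by simp)]
      · simp
      · intro j _ hj
        rw [Nat.choose_eq_zero_of_lt (by omega)]; simp
    · exact sum_eq_zero fun j _ => by simp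
  | succ m ih =>
    obtain ⟨h1, h2⟩ := ih (by omega)
    have e1 := altEven_succ (by omega : 4 * m ≤ 2 * K)
    have e2 := altEven_succ (by omega : 4 * m + 1 ≤ 2 * K)
    have e3 := altEven_succ (by omega : 4 * m + 1 + 1 ≤ 2 * K)
    have e4 := altEven_succ (by omega : 4 * m + 1 + 1 + 1 ≤ 2 * K)
    rw [show 4 * (m + 1) = 4 * m + 1 + 1 + 1 + 1 by ring]
    simp only [altOdd_succ, h1, h2] at e1 e2 e3 e4 ⊢
    rw [pow_succ]
    constructor <;> linarith

lemma altEven_four_mul_add_one (m : ℕ) : altEven (2 * m) (4 * m + 1) = (-4) ^ m := by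
  obtain ⟨h1, h2⟩ := alt_four_mul (by omega : 4 * m ≤ 2 * (2 * m))
  rw [altEven_succ (by omega), h1, h2, sub_zero]

lemma altEven_four_mul_add_three (m : ℕ) :
    altEven (2 * m + 1) (4 * m + 3) = -2 * (-4) ^ m := by
  obtain ⟨h1, h2⟩ := alt_four_mul (by omega : 4 * m ≤ 2 * (2 * m + 1))
  have e1 := altEven_succ (by omega : 4 * m ≤ 2 * (2 * m + 1))
  have e2 := altEven_succ (by omega : 4 * m + 1 ≤ 2 * (2 * m + 1))
  have e3 := altEven_succ (by omega : 4 * m + 1 + 1 ≤ 2 * (2 * m + 1))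
  rw [show 4 * m + 3 = 4 * m + 1 + 1 + 1 by ring]
  simp only [altOdd_succ, h1, h2] at e1 e2 e3 ⊢
  linarith

section
variable {R : Type*} [CommRing R]

lemma prod_natCast_add_one_add {t : R} (ht : t ^ 2 = 0) {v : ℕ → R} {m : ℕ}
    (hv : ∀ i < m, ((i : R) + 1) * v i = 1) :
    ∏ i ∈ range m, ((i : R) + 1 + t) = (m.factorial : R) * (1 + t * ∑ i ∈ range m, v i) := by
  induction m with
  | zero => simp
  | succ m ih =>
    rw [prod_range_succ, ih fun i hi => hv i (by omega), sum_range_succ, Nat.factorial_succ]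
    have := hv m (by omega)
    push_cast
    linear_combination (m.factorial : R) * (∑ i ∈ range m, v i) * ht - m.factorial * t * this

lemma sum_alternating_inverse {v : ℕ → R} {m : ℕ}
    (hv : ∀ i < m, 2 * v (2 * i + 1) = v i) :
    ∑ i ∈ range (2 * m), (-1) ^ (i + 1) * v i =
      ∑ i ∈ range m, v i - ∑ i ∈ range (2 * m), v i := by
  induction m with
  | zero => simp
  | succ m ih =>
    rw [show 2 * (m + 1) = 2 * m + 1 + 1 by ring]
    simp only [sum_range_succ]
    rw [ih fun i hi => hv i (by omega)]
    have := hv m (by omega)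
    have h : (-1 : R) ^ (2 * m) = 1 := by simp
    simp only [pow_succ _ (2 * m), pow_succ _ (2 * m + 1), h]
    linear_combination this

lemma sum_alternating_inverse_succ {v : ℕ → R} {m : ℕ}
    (hv : ∀ i < m, 2 * v (2 * i + 1) = v i) :
    ∑ i ∈ range (2 * m + 1), (-1) ^ (i + 1) * v i =
      ∑ i ∈ range m, v i - ∑ i ∈ range (2 * m + 1), v i := by
  rw [sum_range_succ, sum_alternating_inverse hv, sum_range_succ _ (2 * m), pow_succ]
  simp
  ring
end

lemma mul_choose_pred {R : Type*} [CommRing R] {p : ℕ} (hp : 0 < p) (h2 : (p : R) ^ 2 = 0)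
    {v : ℕ → R} (hv : ∀ i < p - 1, ((i : R) + 1) * v i = 1) {k : ℕ} (hk : k < p) :
    (p : R) * ((p - 1).choose k : R) = p * (-1) ^ k := by
  induction k with
  | zero => simp
  | succ k ih =>
    have h := Nat.choose_succ_right_eq (p - 1) k
    have h' := congrArg (Nat.cast : ℕ → R) h
    have hk1 : ((p - 1 - k : ℕ) : R) = p - 1 - k := by
      rw [Nat.cast_sub (by omega), Nat.cast_sub (by omega), Nat.cast_one]
    push_cast [hk1] at h'
    have h3 := hv k (by omega)
    have h4 := ih (by omega)
    rw [pow_succ]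
    linear_combination (p : R) * v k * h' - (p : R) * ((p - 1).choose (k + 1)) * h3 +
      v k * (p - 1 - k) * h4 + v k * (-1) ^ k * h2 - (p : R) * (-1) ^ k * h3

lemma choose_eq_inverse {R : Type*} [CommRing R] {p : ℕ} (hp : 0 < p) (h2 : (p : R) ^ 2 = 0)
    {v : ℕ → R} (hv : ∀ i < p - 1, ((i : R) + 1) * v i = 1) {k : ℕ} (hk : k < p - 1) :
    (p.choose (k + 1) : R) = p * (-1) ^ k * v k := by
  have h := Nat.add_one_mul_choose_eq (p - 1) k
  rw [Nat.sub_add_cancel hp] at h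
  have h' := congrArg (Nat.cast : ℕ → R) h
  push_cast at h'
  linear_combination -v k * h' - (p.choose (k + 1) : R) * hv k hk +
    v k * mul_choose_pred hp h2 hv (by omega : k < p)

lemma factorial_identity {R : Type*} [CommRing R] {q a b c u N M H F X Z Y s t : R}
    (hq : q ^ 2 = 0) (hc : 2 * c = 1) (hs : s ^ 2 = 1) (hu : 2 * u = 2 + q * (b - a))
    (hX : X = s * (M * (1 - q * a))) (hZ : Z = t * (H * (1 - q * b)))
    (hY : Y = H * (1 + q * b)) (hN : N * X = F) (hH : H * Z = F) :
    (u ^ 2 + 1) * u ^ 3 * (N * M) ^ 2 = 2 * t * H * F * Y := by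
  have hu' : u = 1 + c * q * (b - a) := by linear_combination c * hu - (u - 1) * hc
  have hNM : N * M * s = F * (1 + q * a) := by
    rw [← hN, hX]; linear_combination N * s * M * a ^ 2 * hq
  have hNM2 : (N * M) ^ 2 = F ^ 2 * (1 + 2 * q * a) := by
    linear_combination -(N * M) ^ 2 * hs + (N * M * s + F * (1 + q * a)) * hNM +
      F ^ 2 * a ^ 2 * hq
  have hu2 : u ^ 2 = 1 + q * (b - a) := by
    rw [hu']; linear_combination q * (b - a) * hc + c ^ 2 * (b - a) ^ 2 * hq
  have hu5 : (u ^ 2 + 1) * u ^ 3 = 2 + 4 * q * (b - a) := by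
    rw [show u ^ 3 = u ^ 2 * u by ring, hu2, hu']
    linear_combination q * (b - a) * hc +
      ((b - a) ^ 2 * (1 + 3 * c) + c * q * (b - a) ^ 3) * hq
  have hF : F = H * (t * (H * (1 - q * b))) := by rw [← hH, hZ]
  rw [hu5, hNM2, hY, pow_two F]
  nth_rewrite 2 [hF]
  linear_combination (2 * t * H ^ 2 * F) * (4 * a * (b - a) - 2 * b * (b - a) - 2 * a * b
    - 4 * a * b * (b - a) * q) * hq

section
variable {p : ℕ}

lemma isUnit_natCast_zmod_sq (hp : p.Prime) {i : ℕ} (hi : ¬ p ∣ i) :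
    IsUnit (i : ZMod (p ^ 2)) :=
  (ZMod.isUnit_iff_coprime i (p ^ 2)).2 ((hp.coprime_iff_not_dvd.2 hi).symm.pow_right 2)

lemma natCast_sq_zmod (p : ℕ) : (p : ZMod (p ^ 2)) ^ 2 = 0 := by
  exact_mod_cast ZMod.natCast_self (p ^ 2)

lemma exists_inverse_zmod (hp : p.Prime) :
    ∃ v : ℕ → ZMod (p ^ 2), ∀ i < p - 1, ((i : ZMod (p ^ 2)) + 1) * v i = 1 := by
  refine ⟨fun i => ((i + 1 : ℕ) : ZMod (p ^ 2))⁻¹, fun i hi => ?_⟩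
  have := ZMod.mul_inv_of_unit _ (isUnit_natCast_zmod_sq hp
    (Nat.not_dvd_of_pos_of_lt (by omega) (by omega) : ¬ p ∣ i + 1))
  simpa using this

lemma factorial_mul_prod {R : Type*} [CommRing R] {n m p : ℕ} (h : n + m + 1 = p) :
    (n.factorial : R) * ∏ i ∈ range m, ((p : R) - (i + 1)) = ((p - 1).factorial : R) := by
  induction m generalizing n with
  | zero => simp [← h]
  | succ m ih =>
    have h2 := ih (n := n + 1) (by omega)
    rw [prod_range_succ, ← h2, Nat.factorial_succ, ← h]
    push_cast
    ring

lemma two_mul_altEven (hp : p.Prime) {h : ℕ} (hh : 2 * h + 1 = p) {v : ℕ → ZMod (p ^ 2)}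
    (hv : ∀ i < p - 1, ((i : ZMod (p ^ 2)) + 1) * v i = 1) :
    2 * ((altEven h p : ℤ) : ZMod (p ^ 2)) =
      2 - (p : ZMod (p ^ 2)) * ∑ i ∈ range h, (-1) ^ (i + 1) * v i := by
  rw [altEven, sum_range_succ', mul_comm]
  push_cast
  rw [add_mul, sum_mul, mul_sum]
  rw [sub_eq_add_neg, ← sum_neg_distrib, add_comm]
  congr 1
  · simp
  refine sum_congr rfl fun i hi => ?_
  have hi' := mem_range.1 hi
  have h1 := choose_eq_inverse hp.pos (natCast_sq_zmod p) hv (by omega : 2 * i + 1 < p - 1)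
  have h2 := hv i (by omega)
  have h3 := hv (2 * i + 1) (by omega)
  have h4 : (-1 : ZMod (p ^ 2)) ^ (2 * i) = 1 := by simp
  rw [show 2 * (i + 1) = 2 * i + 1 + 1 by ring, h1, pow_succ _ (2 * i), h4]
  push_cast at h3
  linear_combination (-1) ^ i * p * v i * h3 - (-1) ^ i * p * 2 * v (2 * i + 1) * h2

lemma two_mul_inverse {v : ℕ → ZMod (p ^ 2)}
    (hv : ∀ i < p - 1, ((i : ZMod (p ^ 2)) + 1) * v i = 1) {i : ℕ} (hi : 2 * i + 1 < p - 1) :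
    2 * v (2 * i + 1) = v i := by
  have h2 := hv i (by omega)
  have h3 := hv (2 * i + 1) hi
  push_cast at h3
  linear_combination v i * h3 - 2 * v (2 * i + 1) * h2

lemma mul_altEven (hp : p.Prime) {h : ℕ} (hh : 2 * h + 1 = p) :
    (p : ZMod (p ^ 2)) * (altEven h p : ℤ) = p := by
  obtain ⟨v, hv⟩ := exists_inverse_zmod hp
  have h2 : IsUnit (2 : ZMod (p ^ 2)) := by
    exact_mod_cast isUnit_natCast_zmod_sq hp
      (Nat.not_dvd_of_pos_of_lt (by omega) (by have := hp.two_le; omega) : ¬ p ∣ 2)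
  apply h2.mul_left_cancel
  linear_combination (p : ZMod (p ^ 2)) * two_mul_altEven hp hh hv +
   -
    (∑ i ∈ range h, (-1) ^ (i + 1) * v i) * natCast_sq_zmod p

lemma altEven_factorial (hp : p.Prime) {m h n : ℕ} (hh : 2 * h + 1 = p)
    (hm : h = 2 * m ∨ h = 2 * m + 1) (hn : n + m + 1 = p) :
    (((altEven h p : ℤ) : ZMod (p ^ 2)) ^ 2 + 1) * ((altEven h p : ℤ) : ZMod (p ^ 2)) ^ 3 *
      ((n.factorial : ZMod (p ^ 2)) * m.factorial) ^ 2 =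
    2 * (-1) ^ h * h.factorial * (p - 1).factorial *
      ∏ i ∈ range h, ((i : ZMod (p ^ 2)) + 1 + p) := by
  obtain ⟨v, hv⟩ := exists_inverse_zmod hp
  have hq := natCast_sq_zmod p
  obtain ⟨c, hc⟩ := (isUnit_natCast_zmod_sq hp (i := 2)
    (Nat.not_dvd_of_pos_of_lt (by omega) (by have := hp.two_le; omega))).exists_right_inv
  have hprod : ∀ k ≤ h, ∏ i ∈ range k, ((p : ZMod (p ^ 2)) - (i + 1)) =
      (-1) ^ k * (k.factorial * (1 - p * ∑ i ∈ range k, v i)) := by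
    intro k hk
    have := prod_natCast_add_one_add (t := -(p : ZMod (p ^ 2))) (by rw [neg_sq, hq])
      (v := v) (m := k) fun i hi => hv i (by omega)
    rw [sub_eq_add_neg (1 : ZMod (p ^ 2)), ← neg_mul, ← this, ← card_range k,
      ← prod_const, card_range, ← prod_mul_distrib]
    exact prod_congr rfl fun i _ => by ring
  refine factorial_identity (s := (-1) ^ m) (a := ∑ i ∈ range m, v i) (b := ∑ i ∈ range h, v i)
    hq (by exact_mod_cast hc) (by rw [← pow_mul, mul_comm, pow_mul]; simp) ?_
    (hprod m (by omega)) (hprod h le_rfl)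
    (prod_natCast_add_one_add hq fun i hi => hv i (by omega))
    (factorial_mul_prod hn) (factorial_mul_prod (by omega))
  rw [two_mul_altEven hp hh hv]
  rcases hm with rfl | rfl
  · rw [sum_alternating_inverse fun i hi => two_mul_inverse hv (by omega)]
    ring
  · rw [sum_alternating_inverse_succ fun i hi => two_mul_inverse hv (by omega)]
    ring

lemma not_dvd_factorial (hp : p.Prime) {n : ℕ} (h : n < p) : ¬ p ∣ n.factorial :=
  fun hd => absurd ((hp.dvd_factorial).1 hd) (by omega)

lemma factorial_congr_one (m : ℕ) (hp : p.Prime) (hpm : p = 4 * m + 1) :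
    ((p : ℤ) ^ 2) ∣ (-1) ^ m * (2 ^ (p - 1) + 1) * (4 ^ (3 * m) * (3 * m).factorial ^ 2) -
      2 * (2 * m).choose m * ((p - 1).factorial * ∏ i ∈ range (2 * m), ((i : ℤ) + 1 + p)) := by
  have h := altEven_factorial hp (h := 2 * m) (m := m) (n := 3 * m) (by omega) (by omega)
    (by omega)
  have hM := (isUnit_natCast_zmod_sq hp (not_dvd_factorial hp (by omega : m < p))).pow 2
  have hC := congrArg (Nat.cast : ℕ → ZMod (p ^ 2))
    (Nat.choose_mul_factorial_mul_factorial (by omega : m ≤ 2 * m))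
  rw [show 2 * m - m = m by omega] at hC
  have hE : altEven (2 * m) p = (-4) ^ m := by rw [hpm, altEven_four_mul_add_one]
  have hE2 : ((-4 : ZMod (p ^ 2)) ^ m) ^ 2 = 2 ^ (p - 1) := by
    rw [show p - 1 = 4 * m by omega, ← pow_mul, mul_comm m 2, pow_mul, pow_mul]; norm_num
  have hE3 : ((-4 : ZMod (p ^ 2)) ^ m) ^ 3 = (-1) ^ m * 4 ^ (3 * m) := by
    rw [← pow_mul, mul_comm m 3, pow_mul, pow_mul, ← mul_pow]; norm_num
  rw [hE] at h
  push_cast at h hC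
  rw [hE2, hE3] at h
  have h1 : (-1 : ZMod (p ^ 2)) ^ (2 * m) = 1 := by simp
  rw [h1] at h
  rw [← Int.natCast_pow, ← ZMod.intCast_zmod_eq_zero_iff_dvd]
  apply hM.mul_left_cancel
  push_cast
  linear_combination h - 2 * ((p - 1).factorial : ZMod (p ^ 2)) *
    (∏ i ∈ range (2 * m), ((i : ZMod (p ^ 2)) + 1 + p)) * hC

lemma factorial_congr_three (m : ℕ) (hp : p.Prime) (hpm : p = 4 * m + 3) :
    ((p : ℤ) ^ 2) ∣ (-1) ^ (m + 1) * (2 ^ (p - 1) + 2 * p + 1) *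
      (4 ^ (3 * m + 2) * (3 * m + 2).factorial ^ 2) -
      2 * (2 * m).choose m *
        ((p - 1).factorial * ∏ i ∈ range (2 * m + 1), ((i : ℤ) + 1 + p)) := by
  have h := altEven_factorial hp (h := 2 * m + 1) (m := m) (n := 3 * m + 2) (by omega)
    (by omega) (by omega)
  have hM := ((isUnit_natCast_zmod_sq hp (not_dvd_factorial hp (by omega : m < p))).pow 2).mul
    (isUnit_natCast_zmod_sq hp (Nat.not_dvd_of_pos_of_lt (by omega) (by omega) :
      ¬ p ∣ 2 * m + 1))
  have hq := natCast_sq_zmod p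
  have hC := congrArg (Nat.cast : ℕ → ZMod (p ^ 2))
    (Nat.choose_mul_factorial_mul_factorial (by omega : m ≤ 2 * m))
  rw [show 2 * m - m = m by omega] at hC
  have hE : altEven (2 * m + 1) p = -2 * (-4) ^ m := by rw [hpm, altEven_four_mul_add_three]
  have hE2 : (-2 * (-4 : ZMod (p ^ 2)) ^ m) ^ 2 = 2 ^ (p - 1) := by
    rw [show p - 1 = 2 + 4 * m by omega, mul_pow, ← pow_mul, mul_comm m 2, pow_mul, pow_add,
      pow_mul]
    norm_num
  have hE3 : 2 * (-2 * (-4 : ZMod (p ^ 2)) ^ m) ^ 3 = (-1) ^ (m + 1) * 4 ^ (3 * m + 2) := by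
    have : ((-4 : ZMod (p ^ 2)) ^ m) ^ 3 = (-1) ^ m * 4 ^ (3 * m) := by
      rw [← pow_mul, mul_comm m 3, pow_mul, pow_mul, ← mul_pow]; norm_num
    rw [mul_pow, this]; ring
  have hu := mul_altEven hp (by omega : 2 * (2 * m + 1) + 1 = p)
  have hp4 := congrArg (Nat.cast : ℕ → ZMod (p ^ 2)) hpm
  rw [hE] at h hu
  push_cast [Nat.factorial_succ (2 * m)] at h hC hu hp4
  set u := -2 * (-4 : ZMod (p ^ 2)) ^ m
  have h1 : (-1 : ZMod (p ^ 2)) ^ (2 * m + 1) = -1 := by simp [pow_succ]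
  rw [h1] at h
  rw [← Int.natCast_pow, ← ZMod.intCast_zmod_eq_zero_iff_dvd]
  apply hM.mul_left_cancel
  push_cast
  rw [← hE2]
  clear_value u
  linear_combination
    -((m.factorial : ZMod (p ^ 2)) ^ 2 * (2 * m + 1) * (u ^ 2 + 2 * p + 1) *
      (3 * m + 2).factorial ^ 2) * hE3 - h
    - 2 * (2 * m + 1) * ((p - 1).factorial : ZMod (p ^ 2)) *
      (∏ i ∈ range (2 * m + 1), ((i : ZMod (p ^ 2)) + 1 + p)) * hC
    + ((m.factorial : ZMod (p ^ 2)) ^ 2 * (3 * m + 2).factorial ^ 2 * u ^ 3) *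
      ((u + 1) * hu + 2 * hq - (u ^ 2 + 2 * p + 1) * hp4)
end

section
variable {p : ℕ}

/-- The subring of `p`-integers of `ℚ`. -/
def pIntegers (hp : p.Prime) : Subring ℚ where
  carrier := {x | isPInt p x}
  mul_mem' {x y} hx hy h := (hp.dvd_mul.1 (h.trans (Rat.mul_den_dvd x y))).elim hx hy
  one_mem' := by simpa [isPInt] using hp.ne_one
  add_mem' {x y} hx hy h := (hp.dvd_mul.1 (h.trans (Rat.add_den_dvd x y))).elim hx hy
  zero_mem' := by simpa [isPInt] using hp.ne_one
  neg_mem' {x} hx := by simpa [isPInt] using hx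

/-- The `p`-integers divisible by `p ^ k`, as an additive subgroup of `ℚ`. -/
def pMultiples (hp : p.Prime) (k : ℕ) : AddSubgroup ℚ :=
  (pIntegers hp).toAddSubgroup.comap (AddMonoidHom.mulRight ((p : ℚ) ^ k)⁻¹)


lemma mem_pMultiples (hp : p.Prime) {k : ℕ} {x : ℚ} :
    x ∈ pMultiples hp k ↔ x / (p : ℚ) ^ k ∈ pIntegers hp :=
  Iff.rfl

lemma mul_mem_pMultiples (hp : p.Prime) {k l : ℕ} {x y : ℚ} (hx : x ∈ pMultiples hp k)
    (hy : y ∈ pMultiples hp l) : x * y ∈ pMultiples hp (k + l) := by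
  rw [mem_pMultiples] at *
  rw [pow_add, mul_div_mul_comm]
  exact mul_mem hx hy

lemma mul_mem_pMultiples_right (hp : p.Prime) {k : ℕ} {x y : ℚ} (hx : x ∈ pIntegers hp)
    (hy : y ∈ pMultiples hp k) : x * y ∈ pMultiples hp k := by
  simpa using mul_mem_pMultiples hp (k := 0) (by simpa [mem_pMultiples] using hx) hy

lemma natCast_mul_mem_pMultiples_one (hp : p.Prime) {x : ℚ} (hx : x ∈ pIntegers hp) :
    (p : ℚ) * x ∈ pMultiples hp 1 := by
  have : (p : ℚ) ≠ 0 := by exact_mod_cast hp.ne_zero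
  rw [mem_pMultiples, pow_one, mul_div_cancel_left₀ _ this]
  exact hx

lemma intCast_mem_pMultiples (hp : p.Prime) {k : ℕ} {z : ℤ} (hz : (p : ℤ) ^ k ∣ z) :
    (z : ℚ) ∈ pMultiples hp k := by
  obtain ⟨c, rfl⟩ := hz
  have : (p : ℚ) ≠ 0 := by exact_mod_cast hp.ne_zero
  rw [mem_pMultiples]
  push_cast
  rw [mul_div_cancel_left₀ _ (pow_ne_zero _ this)]
  exact intCast_mem _ c

lemma inv_natCast_mem_pIntegers (hp : p.Prime) {z : ℕ} (hz : ¬ p ∣ z) :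
    (z : ℚ)⁻¹ ∈ pIntegers hp := by
  have hz0 : 0 < z := Nat.pos_of_ne_zero fun h => hz (h ▸ dvd_zero p)
  change ¬ p ∣ (z : ℚ)⁻¹.den
  rwa [Rat.inv_natCast_den_of_pos hz0]

lemma inv_intCast_mem_pIntegers (hp : p.Prime) {z : ℤ} (hz : ¬ (p : ℤ) ∣ z) :
    (z : ℚ)⁻¹ ∈ pIntegers hp := by
  obtain ⟨n, rfl | rfl⟩ := Int.eq_nat_or_neg z
  · exact_mod_cast inv_natCast_mem_pIntegers hp (mt Int.natCast_dvd_natCast.2 hz)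
  · rw [Int.dvd_neg, Int.natCast_dvd_natCast] at hz
    push_cast
    rw [inv_neg]
    exact neg_mem (inv_natCast_mem_pIntegers hp hz)

lemma prod_mem_pMultiples_one (hp : p.Prime) {f : ℕ → ℚ} {s : Finset ℕ} {j : ℕ} (hj : j ∈ s)
    (hf : ∀ i ∈ s, f i ∈ pIntegers hp) (h : f j ∈ pMultiples hp 1) :
    ∏ i ∈ s, f i ∈ pMultiples hp 1 := by
  rw [← prod_erase_mul _ _ hj]
  exact mul_mem_pMultiples_right hp (prod_mem fun i hi => hf i (mem_of_mem_erase hi)) h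

lemma prod_sub_prod_mem_pMultiples (hp : p.Prime) {k : ℕ} {f g : ℕ → ℚ} {s : Finset ℕ}
    (hf : ∀ i ∈ s, f i ∈ pIntegers hp) (hg : ∀ i ∈ s, g i ∈ pIntegers hp)
    (h : ∀ i ∈ s, f i - g i ∈ pMultiples hp k) :
    ∏ i ∈ s, f i - ∏ i ∈ s, g i ∈ pMultiples hp k := by
  induction s using Finset.induction_on with
  | empty => simp
  | insert j s hj ih =>
    simp only [mem_insert, forall_eq_or_imp] at hf hg h
    rw [prod_insert hj, prod_insert hj]
    have e := add_mem (mul_mem_pMultiples_right hp hf.1 (ih hf.2 hg.2 h.2))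
      (mul_mem_pMultiples_right hp (prod_mem hg.2) h.1)
    convert e using 1
    ring

lemma not_dvd_four (hp : p.Prime) (hp3 : 3 < p) : ¬ p ∣ 4 := by
  intro h
  have := (Nat.prime_dvd_prime_iff_eq hp Nat.prime_two).1
    (hp.dvd_of_dvd_pow (show p ∣ 2 ^ 2 from h))
  omega

lemma inv_four_mem (hp : p.Prime) (hp3 : 3 < p) : (4 : ℚ)⁻¹ ∈ pIntegers hp := by
  exact_mod_cast inv_natCast_mem_pIntegers hp (not_dvd_four hp hp3)

lemma shift_inv_mem (hp : p.Prime) (hp3 : 3 < p) (c : ℤ) {i : ℤ} (hi : ¬ (p : ℤ) ∣ i) :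
    ((i : ℚ) + c * p / 4)⁻¹ ∈ pIntegers hp := by
  have h : ¬ (p : ℤ) ∣ 4 * i + c * p := by
    rw [dvd_add_left (dvd_mul_left _ _)]
    intro hd
    exact ((Nat.prime_iff_prime_int.1 hp).dvd_or_dvd hd).elim
      (fun h4 => not_dvd_four hp hp3 (Int.natCast_dvd_natCast.1 h4)) hi
  have e : ((i : ℚ) + c * p / 4)⁻¹ = (4 : ℤ) * ((4 * i + c * p : ℤ) : ℚ)⁻¹ := by
    push_cast
    rw [← inv_inv (4 : ℚ), ← mul_inv]
    congr 1
    ring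
  rw [e]
  exact mul_mem (intCast_mem _ 4) (inv_intCast_mem_pIntegers hp h)

lemma three_quarter_mem (hp : p.Prime) (hp3 : 3 < p) :
    (3 * p / 4 : ℚ) ∈ pMultiples hp 1 := by
  have h := natCast_mul_mem_pMultiples_one hp
    (mul_mem (natCast_mem (pIntegers hp) 3) (inv_four_mem hp hp3))
  convert h using 1
  push_cast
  ring

lemma mem_pIntegers_of_mem_pMultiples (hp : p.Prime) {k : ℕ} {x : ℚ}
    (hx : x ∈ pMultiples hp k) : x ∈ pIntegers hp := by
  rw [mem_pMultiples] at hx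
  have h0 : (p : ℚ) ≠ 0 := by exact_mod_cast hp.ne_zero
  have := mul_mem (pow_mem (natCast_mem (pIntegers hp) p) k) hx
  rwa [mul_div_cancel₀ _ (pow_ne_zero _ h0)] at this

lemma inv_sq_mem (hp : p.Prime) {i : ℕ} (hi : i + 1 < p) :
    (((i : ℚ) + 1) ^ 2)⁻¹ ∈ pIntegers hp := by
  rw [← inv_pow]
  refine pow_mem ?_ 2
  exact_mod_cast inv_natCast_mem_pIntegers hp
    (Nat.not_dvd_of_pos_of_lt (by omega) hi : ¬ p ∣ i + 1)

lemma legendreCoeff_factor_mem (hp : p.Prime) {a : ℚ} (ha : a ∈ pIntegers hp) {i : ℕ}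
    (hi : i + 1 < p) :
    ((i : ℚ) * (i + 1) - a * (a + 1)) / ((i : ℚ) + 1) ^ 2 ∈ pIntegers hp := by
  have hi' := natCast_mem (pIntegers hp) i
  have h1 := one_mem (pIntegers hp)
  exact mul_mem (sub_mem (mul_mem hi' (add_mem hi' h1)) (mul_mem ha (add_mem ha h1)))
    (inv_sq_mem hp hi)

lemma legendreCoeff_sub_mem (hp : p.Prime) {a b : ℚ} (ha : a ∈ pIntegers hp)
    (hb : b ∈ pIntegers hp) (hab : b - a ∈ pMultiples hp 1) {k : ℕ} (hk : k < p) :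
    legendreCoeff a k - legendreCoeff b k ∈ pMultiples hp 1 := by
  have hlt : ∀ i ∈ range k, i + 1 < p := fun i hi => by have := mem_range.1 hi; omega
  refine prod_sub_prod_mem_pMultiples hp (fun i hi => legendreCoeff_factor_mem hp ha (hlt i hi))
    (fun i hi => legendreCoeff_factor_mem hp hb (hlt i hi)) fun i hi => ?_
  have h1 := one_mem (pIntegers hp)
  have := mul_mem_pMultiples_right hp
    (mul_mem (inv_sq_mem hp (hlt i hi)) (add_mem (add_mem hb ha) h1)) hab
  convert this using 1
  have h0 : ((i : ℚ) + 1) ≠ 0 := by positivity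
  field_simp
  ring

lemma sq_mul_legendreCoeff_mem (hp : p.Prime) {a : ℚ} {n m : ℕ} (ha : a ∈ pIntegers hp)
    (hna : n - a ∈ pMultiples hp 1) (hm : 0 < m) (hn : 0 < n) (hnm : n + m + 1 = p) :
    (p : ℚ) ^ 2 * legendreCoeff a p ∈ pMultiples hp 2 := by
  obtain ⟨q, rfl⟩ : ∃ q, p = q + 1 := ⟨p - 1, by omega⟩
  have h1 := one_mem (pIntegers hp)
  have hi' := natCast_mem (pIntegers hp)
  push_cast
  rw [legendreCoeff_succ]
  refine mul_mem_pMultiples_right hp (sub_mem (mul_mem (hi' q) (add_mem (hi' q) h1))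
    (mul_mem ha (add_mem ha h1))) ?_
  have e : legendreCoeff a q = (∏ i ∈ range q, (((i : ℚ) + 1) ^ 2)⁻¹) *
      ((∏ i ∈ range q, ((i : ℚ) - a)) * ∏ i ∈ range q, ((i : ℚ) + a + 1)) := by
    rw [legendreCoeff, ← prod_mul_distrib, ← prod_mul_distrib]
    refine prod_congr rfl fun i _ => ?_
    rw [div_eq_inv_mul]
    ring
  rw [e]
  refine mul_mem_pMultiples_right hp
    (prod_mem fun i hi => inv_sq_mem hp (by have := mem_range.1 hi; omega))
    (mul_mem_pMultiples hp (k := 1) (l := 1) ?_ ?_)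
  · exact prod_mem_pMultiples_one hp (mem_range.2 (by omega : n < q))
      (fun i _ => sub_mem (hi' i) ha) hna
  · refine prod_mem_pMultiples_one hp (mem_range.2 (by omega : m < q))
      (fun i _ => add_mem (add_mem (hi' i) ha) h1) ?_
    have h := sub_mem (natCast_mul_mem_pMultiples_one hp h1) hna
    convert h using 1
    rw [← hnm]
    push_cast
    ring

lemma add_three_quarter_ne_zero (hp : p.Prime) (k : ℤ) :
    (k : ℚ) + 3 * p / 4 ≠ 0 := by
  intro h
  have h1 : (4 * k + 3 * p : ℚ) = 0 := by linarith
  have h2 : 4 * k + 3 * (p : ℤ) = 0 := by exact_mod_cast h1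
  have := hp.eq_two_or_odd
  omega

lemma legendreSum_step (hp : p.Prime) (hp3 : 3 < p) {n m i : ℕ} (hm : 0 < m)
    (hnm : n + m + 1 = p) (hi : i < n) {a b : ℚ} (ha : a = n - 3 * p / 4)
    (hb : b = 3 * p / 4 - (i + 1)) :
    b ^ 2 * legendreSum p a b - (b - a) * (b + a + 1) * legendreSum p a (b + 1) ∈
      pMultiples hp 2 := by
  have hβ := three_quarter_mem hp hp3
  have haR : a ∈ pIntegers hp :=
    ha ▸ sub_mem (natCast_mem _ n) (mem_pIntegers_of_mem_pMultiples hp hβ)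
  rw [legendreSum_add_one]
  · have h1 := sq_mul_legendreCoeff_mem hp haR (n := n) (m := m)
      (by rw [ha, sub_sub_cancel]; exact hβ) hm (by omega) hnm
    have h2 : ((p : ℚ) + b)⁻¹ ∈ pIntegers hp := by
      have := shift_inv_mem hp hp3 3 (i := p - (i + 1)) (by
        rw [dvd_sub_right dvd_rfl]
        exact_mod_cast Nat.not_dvd_of_pos_of_lt (by omega) (by omega : i + 1 < p))
      rw [hb]
      convert this using 2
      push_cast
      ring
    have := neg_mem (mul_mem_pMultiples_right hp h2 h1)
    convert this using 1
    rw [div_eq_mul_inv]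
    ring
  · intro k h
    refine add_three_quarter_ne_zero hp (k - (i + 1)) ?_
    push_cast
    rw [hb] at h
    linarith

lemma legendreSum_chain (hp : p.Prime) (hp3 : 3 < p) {n m i : ℕ} (hm : 0 < m)
    (hnm : n + m + 1 = p) (hi : i ≤ n) {a β : ℚ} (hβ : β = 3 * p / 4) (ha : a = n - β) :
    legendreSum p a (β - i) * (∏ l ∈ range i, (β - (l + 1))) ^ 2 -
      (∏ l ∈ range i, (2 * β - n - (l + 1)) * (n - l)) * legendreSum p a β ∈
      pMultiples hp 2 := by
  have hβR : β ∈ pIntegers hp :=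
    hβ ▸ mem_pIntegers_of_mem_pMultiples hp (three_quarter_mem hp hp3)
  have hc := natCast_mem (pIntegers hp)
  have h1 := one_mem (pIntegers hp)
  induction i with
  | zero => simp
  | succ i ih =>
    have hstep := legendreSum_step hp hp3 hm hnm (by omega : i < n) (hβ ▸ ha)
      (b := β - (i + 1)) (by rw [hβ])
    have e1 := mul_mem_pMultiples_right hp (pow_mem (prod_mem (t := range i) fun l _ =>
      sub_mem hβR (add_mem (hc l) h1)) 2) hstep
    have e2 := mul_mem_pMultiples_right hp (mul_mem (sub_mem (sub_mem (mul_mem (hc 2) hβR) (hc n))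
      (add_mem (hc i) h1)) (sub_mem (hc n) (hc i))) (ih (by omega))
    convert add_mem e1 e2 using 1
    rw [prod_range_succ, prod_range_succ, show β - (i + 1) + 1 = β - i by ring, ha]
    push_cast
    ring

lemma legendreSum_sub_mem (hp : p.Prime) (hp3 : 3 < p) {n : ℕ} {a β : ℚ}
    (hβ : β = 3 * p / 4) (ha : a = n - β) :
    β * (legendreSum p a β - legendreSum p n β) ∈ pMultiples hp 2 := by
  have hβ1 : β ∈ pMultiples hp 1 := hβ ▸ three_quarter_mem hp hp3
  have hβR := mem_pIntegers_of_mem_pMultiples hp hβ1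
  have hc := natCast_mem (pIntegers hp)
  rw [legendreSum, legendreSum, ← sum_sub_distrib, mul_sum]
  refine sum_mem fun k hk => ?_
  have hk' := mem_range.1 hk
  rcases Nat.eq_zero_or_pos k with rfl | hk0
  · simp [legendreCoeff_zero]
  have h1 := mul_mem_pMultiples hp hβ1 (legendreCoeff_sub_mem hp (a := a) (b := n)
    (ha ▸ sub_mem (hc n) hβR) (hc n) (by rw [ha, sub_sub_cancel]; exact hβ1) hk')
  have h2 := shift_inv_mem hp hp3 3 (i := k)
    (by exact_mod_cast Nat.not_dvd_of_pos_of_lt hk0 hk')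
  convert mul_mem_pMultiples_right hp h2 h1 using 1
  rw [hβ]
  push_cast
  ring

lemma legendreSum_congr (hp : p.Prime) (hp3 : 3 < p) {n m h : ℕ} (hm : 0 < m)
    (hnm : n + m + 1 = p)
    (hE : (4 : ℚ) ^ n * ∏ l ∈ range n, (3 * (p : ℚ) / 2 - n - (l + 1)) * (n - l) =
      ((p + h).factorial : ℚ)) :
    legendreSum p (n - 3 * p / 4) (3 * p / 4 - n) / 4 * (3 * (4 ^ n * n.factorial ^ 2)) -
      (p - 1).factorial * ∏ i ∈ range h, ((i : ℚ) + 1 + p) ∈ pMultiples hp 2 := by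
  set β : ℚ := 3 * p / 4 with hβ
  set a : ℚ := n - β with ha
  set W : ℚ := (p - 1).factorial * ∏ i ∈ range h, ((i : ℚ) + 1 + p) with hW
  set P := ∏ l ∈ range n, (β - (l + 1)) with hP
  set Q := ∏ l ∈ range n, ((l : ℚ) + 1 + β) with hQ
  have hp0 : (0 : ℚ) < p := by exact_mod_cast hp.pos
  have hβ0 : 0 < β := by positivity
  have hβ1 : β ∈ pMultiples hp 1 := three_quarter_mem hp hp3
  have hβR := mem_pIntegers_of_mem_pMultiples hp hβ1
  have hc := natCast_mem (pIntegers hp)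
  have h1 := one_mem (pIntegers hp)
  have h4 := inv_four_mem hp hp3
  have hWR : W ∈ pIntegers hp :=
    mul_mem (hc _) (prod_mem fun i _ => add_mem (add_mem (hc i) h1) (hc p))
  have hfac : ((p + h).factorial : ℚ) = p * W := by
    have : ∀ k, ((p + k).factorial : ℚ) =
        p.factorial * ∏ i ∈ range k, ((i : ℚ) + 1 + p) := by
      intro k
      induction k with
      | zero => simp
      | succ k ih =>
        rw [prod_range_succ, ← mul_assoc, ← ih, ← add_assoc, Nat.factorial_succ]
        push_cast
        ring
    rw [this, hW, ← Nat.mul_factorial_pred hp.ne_zero]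
    push_cast
    ring
  have hPne : ∀ l : ℕ, β - (l + 1) ≠ 0 := fun l h0 =>
    add_three_quarter_ne_zero hp (-(l + 1)) (by push_cast; linarith)
  have hPinv : P⁻¹ ∈ pIntegers hp := by
    rw [hP, ← prod_inv_distrib]
    refine prod_mem fun l hl => ?_
    have hl' := mem_range.1 hl
    have e : β - (l + 1) = ((-(l + 1) : ℤ) : ℚ) + (3 : ℤ) * p / 4 := by
      rw [hβ]
      push_cast
      ring
    rw [e]
    exact shift_inv_mem hp hp3 3 (i := -(l + 1)) (by
      rw [Int.dvd_neg]
      exact_mod_cast Nat.not_dvd_of_pos_of_lt (by omega) (by omega : l + 1 < p))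
  have hQinv : Q⁻¹ ∈ pIntegers hp := by
    rw [hQ, ← prod_inv_distrib]
    refine prod_mem fun l hl => ?_
    have hl' := mem_range.1 hl
    have e : (l : ℚ) + 1 + β = ((l + 1 : ℤ) : ℚ) + (3 : ℤ) * p / 4 := by
      rw [hβ]
      push_cast
      ring
    rw [e]
    exact shift_inv_mem hp hp3 3 (i := l + 1) (by
      exact_mod_cast Nat.not_dvd_of_pos_of_lt (by omega) (by omega : l + 1 < p))
  have hP0 : P ≠ 0 := prod_ne_zero_iff.2 fun l _ => hPne l
  have hQ0 : Q ≠ 0 := prod_ne_zero_iff.2 fun l _ => by positivity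
  have hQR : Q ∈ pIntegers hp := prod_mem fun l _ => add_mem (add_mem (hc l) h1) hβR
  have hexact : legendreSum p n β * (β * Q) = (-1) ^ n * P := by
    rw [legendreSum_natCast (by omega) hβ0, hP, ← card_range n, ← prod_const, card_range,
      ← prod_mul_distrib]
    exact prod_congr rfl fun l _ => by ring
  have hE' : ∏ l ∈ range n, (2 * β - n - (l + 1)) * (n - l) = 4⁻¹ ^ n * (p * W) := by
    rw [← hfac, ← hE, ← mul_assoc, ← mul_pow, inv_mul_cancel₀ (by norm_num), one_pow, one_mul]
    exact prod_congr rfl fun l _ => by rw [hβ]; ring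
  have hchain := legendreSum_chain hp hp3 hm hnm le_rfl hβ ha
  rw [hE'] at hchain
  have hsub := legendreSum_sub_mem hp hp3 hβ ha
  set U := 3 * 4 ^ n / 4 * legendreSum p a (β - n) with hU
  set V := (-1) ^ n * (P * Q) with hV
  have hone : (-1 : ℚ) ^ n * (-1) ^ n = 1 := by rw [← mul_pow]; norm_num
  have h4n : (4⁻¹ : ℚ) ^ n * 4 ^ n = 1 := by rw [← mul_pow]; norm_num
  have hUV : U * V - W ∈ pMultiples hp 2 := by
    have e1 := add_mem (mul_mem_pMultiples_right hp (hc 3) hchain)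
      (mul_mem_pMultiples_right hp (mul_mem (mul_mem (pow_mem h4 n) (hc 4)) hWR) hsub)
    have e2 := mul_mem_pMultiples_right hp (mul_mem (mul_mem (mul_mem (hc 4) h4) h4)
      (mul_mem (mul_mem (pow_mem (neg_mem h1) n) (pow_mem (hc 4) n)) (mul_mem hQR hPinv))) e1
    convert e2 using 1
    have hpβ : (p : ℚ) = 4 * β / 3 := by rw [hβ]; ring
    have hW' : W = 4⁻¹ ^ n * 4 ^ n * ((-1) ^ n * P⁻¹ * W) *
        (legendreSum p n β * (β * Q)) := by
      rw [hexact, h4n]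
      linear_combination -W * hone - (-1) ^ n * (-1) ^ n * W * inv_mul_cancel₀ hP0
    rw [hpβ, hU, hV]
    nth_rewrite 1 [hW']
    push_cast
    linear_combination -(3 / 4 * 4 ^ n * legendreSum p a (β - n) * (-1) ^ n * Q * P) *
      inv_mul_cancel₀ hP0
  have hVinv : V⁻¹ ∈ pIntegers hp := by
    rw [hV, mul_inv, mul_inv, ← inv_pow, inv_neg, inv_one]
    exact mul_mem (pow_mem (neg_mem h1) n) (mul_mem hPinv hQinv)
  have hV0 : V ≠ 0 := mul_ne_zero (pow_ne_zero _ (by norm_num)) (mul_ne_zero hP0 hQ0)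
  have hUR : U ∈ pIntegers hp := by
    have := mul_mem (add_mem (mem_pIntegers_of_mem_pMultiples hp hUV) hWR) hVinv
    rwa [sub_add_cancel, mul_inv_cancel_right₀ hV0] at this
  have hVn : V - (n.factorial : ℚ) ^ 2 ∈ pMultiples hp 2 := by
    have e1 : V = ∏ l ∈ range n, (((l : ℚ) + 1) ^ 2 - β ^ 2) := by
      rw [hV, hP, hQ, ← prod_mul_distrib, ← card_range n, ← prod_const, card_range,
        ← prod_mul_distrib]
      exact prod_congr rfl fun l _ => by ring
    have e2 : (n.factorial : ℚ) ^ 2 = ∏ l ∈ range n, ((l : ℚ) + 1) ^ 2 := by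
      rw [prod_pow, ← prod_range_add_one_eq_factorial]
      push_cast
      rfl
    rw [e1, e2]
    have hsq : ∀ l : ℕ, ((l : ℚ) + 1) ^ 2 ∈ pIntegers hp :=
      fun l => pow_mem (add_mem (hc l) h1) 2
    refine prod_sub_prod_mem_pMultiples hp (fun l _ => sub_mem (hsq l) (pow_mem hβR 2))
      (fun l _ => hsq l) fun l _ => ?_
    convert neg_mem (mul_mem_pMultiples hp hβ1 hβ1) using 1
    ring
  convert sub_mem hUV (mul_mem_pMultiples_right hp hUR hVn) using 1
  rw [hU]
  ring

/-- Assembles `legendreSum_congr` with an integer congruence for the closed form. -/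
lemma legendreSum_pCong (hp : p.Prime) (hp3 : 3 < p) {n m h C : ℕ} {E : ℤ} {a b : ℚ}
    (hm : 0 < m) (hnm : n + m + 1 = p) (ha : a = n - 3 * p / 4) (hb : b = 3 * p / 4 - n)
    (hE : (4 : ℚ) ^ n * ∏ l ∈ range n, (3 * (p : ℚ) / 2 - n - (l + 1)) * (n - l) =
      ((p + h).factorial : ℚ)) (hC : ¬ p ∣ C)
    (hEC : (p : ℤ) ^ 2 ∣ E * (4 ^ n * n.factorial ^ 2) -
      2 * C * ((p - 1).factorial * ∏ i ∈ range h, ((i : ℤ) + 1 + p))) :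
    pCong p 2 (legendreSum p a b / 4) (E / (6 * C)) := by
  subst ha hb
  have h1 := legendreSum_congr hp hp3 hm hnm hE
  have h2 := intCast_mem_pMultiples hp hEC
  have hn := not_dvd_factorial hp (by omega : n < p)
  have hn2 : n.factorial ≠ 0 := n.factorial_ne_zero
  have hC0 : C ≠ 0 := fun h => hC (h ▸ dvd_zero p)
  have h64 : ¬ p ∣ 6 * C * (4 ^ n * n.factorial ^ 2) := by
    intro hd
    rcases hp.dvd_mul.1 hd with hd | hd
    · rcases hp.dvd_mul.1 hd with hd | hd
      · rcases hp.dvd_mul.1 (show p ∣ 2 * 3 from hd) with hd | hd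
        all_goals exact absurd (Nat.le_of_dvd (by norm_num) hd) (by omega)
      · exact hC hd
    · rcases hp.dvd_mul.1 hd with hd | hd
      · exact not_dvd_four hp hp3 (hp.dvd_of_dvd_pow hd)
      · exact hn (hp.dvd_of_dvd_pow hd)
  have h3 := mul_mem_pMultiples_right hp (inv_natCast_mem_pIntegers hp h64)
    (sub_mem (mul_mem_pMultiples_right hp (natCast_mem _ (2 * C)) h1) h2)
  refine (mem_pMultiples hp).1 ?_
  convert h3 using 1
  push_cast
  field_simp
  ring

end

lemma prod_four_mul_add_one (m : ℕ) {p : ℚ} (hp : p = 4 * m + 1) :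
    (4 : ℚ) ^ (3 * m) * ∏ l ∈ range (3 * m),
      (3 * p / 2 - (3 * m : ℕ) - (l + 1)) * ((3 * m : ℕ) - l) = ((6 * m + 1).factorial : ℚ) := by
  have key : ∀ n : ℕ, ∏ l ∈ range n, (2 * (l : ℚ) + 3) * (2 * l + 2) =
      ((2 * n + 1).factorial : ℚ) := by
    intro n
    induction n with
    | zero => simp
    | succ n ih =>
      rw [prod_range_succ, ih, show 2 * (n + 1) + 1 = 2 * n + 1 + 1 + 1 by ring,
        Nat.factorial_succ (2 * n + 1 + 1), Nat.factorial_succ (2 * n + 1)]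
      push_cast
      ring
  rw [show 6 * m + 1 = 2 * (3 * m) + 1 by ring, ← key, ← prod_range_reflect]
  nth_rewrite 1 [← card_range (3 * m)]
  rw [← prod_const, ← prod_mul_distrib]
  refine prod_congr rfl fun l hl => ?_
  have hl' := mem_range.1 hl
  rw [hp, Nat.sub_sub, Nat.cast_sub (by omega)]
  push_cast
  ring

lemma prod_four_mul_add_three (m : ℕ) {p : ℚ} (hp : p = 4 * m + 3) :
    (4 : ℚ) ^ (3 * m + 2) * ∏ l ∈ range (3 * m + 2),
      (3 * p / 2 - (3 * m + 2 : ℕ) - (l + 1)) * ((3 * m + 2 : ℕ) - l) =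
      ((6 * m + 4).factorial : ℚ) := by
  have key : ∀ n : ℕ, ∏ l ∈ range n, (2 * (l : ℚ) + 1) * (2 * l + 2) =
      ((2 * n).factorial : ℚ) := by
    intro n
    induction n with
    | zero => simp
    | succ n ih =>
      rw [prod_range_succ, ih, show 2 * (n + 1) = 2 * n + 1 + 1 by ring,
        Nat.factorial_succ (2 * n + 1), Nat.factorial_succ (2 * n)]
      push_cast
      ring
  rw [show 6 * m + 4 = 2 * (3 * m + 2) by ring, ← key, ← prod_range_reflect]
  nth_rewrite 1 [← card_range (3 * m + 2)]
  rw [← prod_const, ← prod_mul_distrib]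
  refine prod_congr rfl fun l hl => ?_
  have hl' := mem_range.1 hl
  rw [hp, Nat.sub_sub, Nat.cast_sub (by omega)]
  push_cast
  ring

lemma not_dvd_choose_two_mul {p m : ℕ} (hp : p.Prime) (h : 2 * m < p) :
    ¬ p ∣ (2 * m).choose m := fun hd => not_dvd_factorial hp h <| by
  rw [← Nat.choose_mul_factorial_mul_factorial (by omega : m ≤ 2 * m), mul_assoc]
  exact hd.mul_right _

lemma sum_eq_legendreSum_div_four (M : ℕ) {a b c : ℚ} (ha : a * (a + 1) = -3 / 16)
    (hb : c = 4 * b) :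
    ∑ k ∈ range M, ((2 * k).choose k : ℚ) * ((4 * k).choose (2 * k) : ℚ) /
      (64 ^ k * (4 * (k : ℚ) + c)) = legendreSum M a b / 4 := by
  rw [legendreSum, sum_div]
  refine sum_congr rfl fun k _ => ?_
  rw [legendreCoeff_quarter ha, hb, ← mul_add, div_div, div_div]
  ring

end

theorem stmt6 (p : ℕ) (hp : p.Prime) (hp3 : 3 < p) :
    (p % 4 = 1 →
      pCong p 2
        (∑ k ∈ Finset.range p,
          ((2 * k).choose k : ℚ) * ((4 * k).choose (2 * k) : ℚ) / (64 ^ k * (4 * (k : ℚ) + 3)))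
        ((-1 : ℚ) ^ ((p - 1) / 4) * ((2 : ℚ) ^ (p - 1) + 1) /
          (6 * (((p - 1) / 2).choose ((p - 1) / 4) : ℚ)))) ∧
    (p % 4 = 3 →
      pCong p 2
        (∑ k ∈ Finset.range p,
          ((2 * k).choose k : ℚ) * ((4 * k).choose (2 * k) : ℚ) / (64 ^ k * (4 * (k : ℚ) + 1)))
        ((-1 : ℚ) ^ ((p + 1) / 4) * ((2 : ℚ) ^ (p - 1) + 2 * (p : ℚ) + 1) /
          (6 * (((p - 3) / 2).choose ((p - 3) / 4) : ℚ)))) := by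
  refine ⟨fun h4 => ?_, fun h4 => ?_⟩
  · obtain ⟨m, rfl⟩ : ∃ m, p = 4 * m + 1 := ⟨p / 4, by omega⟩
    rw [show (4 * m + 1 - 1) / 4 = m by omega, show (4 * m + 1 - 1) / 2 = 2 * m by omega,
      sum_eq_legendreSum_div_four _ (a := -3 / 4) (b := 3 / 4) (by norm_num) (by norm_num)]
    have h := legendreSum_pCong hp hp3 (n := 3 * m) (m := m) (h := 2 * m) (a := -3 / 4)
      (b := 3 / 4) (by omega) (by omega) (by push_cast; ring) (by push_cast; ring)
      (by rw [prod_four_mul_add_one m (by push_cast; ring)]; congr 2; omega)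
      (not_dvd_choose_two_mul hp (by omega)) (factorial_congr_one m hp rfl)
    push_cast at h ⊢
    exact h
  · obtain ⟨m, rfl⟩ : ∃ m, p = 4 * m + 3 := ⟨p / 4, by omega⟩
    rw [show (4 * m + 3 + 1) / 4 = m + 1 by omega, show (4 * m + 3 - 3) / 4 = m by omega,
      show (4 * m + 3 - 3) / 2 = 2 * m by omega,
      sum_eq_legendreSum_div_four _ (a := -1 / 4) (b := 1 / 4) (by norm_num) (by norm_num)]
    have h := legendreSum_pCong hp hp3 (n := 3 * m + 2) (m := m) (h := 2 * m + 1) (a := -1 / 4)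
      (b := 1 / 4) (by omega) (by omega) (by push_cast; ring) (by push_cast; ring)
      (by rw [prod_four_mul_add_three m (by push_cast; ring)]; congr 2; omega)
      (not_dvd_choose_two_mul hp (by omega)) (factorial_congr_three m hp rfl)
    push_cast at h ⊢
    exact h
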